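/- Fix 0 ≤ d ≤ n. Let 0 → D → A → F → 0 and 0 → A → B → C → 0 be short exact sequences of left D_n-modules presented as quotients D = P_D/I_D, A = P_A/I_A, F = P_F/I_F, B = P_B/I_B, C = P_C/I_C of finitely generated free D_n-modules, and let a shift vector 𝔪_C for P_C be given. Then one can re-present A as a quotient of Q_A = P_D ⊕ P_F and B as a quotient of Q_B = P_D ⊕ P_F ⊕ P_C, compatibly with all the given maps, and find shift vectors 𝔪_D, 𝔪_F, 𝔪_A = (𝔪_D, 𝔪_F), 𝔪_B = (𝔪_D, 𝔪_F, 𝔪_C) such that both short exact sequences become V_d-strict with respect to the induced quotient filtrations (exact on every filtration level F^j). -/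

import Mathlib

set_option synthInstance.maxHeartbeats 1000000
set_option maxHeartbeats 4000000
set_option linter.unusedVariables false

open scoped TensorProduct

noncomputable section

/-- The polynomial ring `R = ℂ[x₁,…,xₙ]`. -/
abbrev Rp (n : ℕ) := MvPolynomial (Fin n) ℂ

/-- Multiplication by `xᵢ`, as a `ℂ`-linear endomorphism of `ℂ[x₁,…,xₙ]`. -/
def mulOp {n : ℕ} (i : Fin n) : Module.End ℂ (Rp n) :=
  LinearMap.mulLeft ℂ (MvPolynomial.X i)

/-- The partial derivative `∂ᵢ`, as a `ℂ`-linear endomorphism of `ℂ[x₁,…,xₙ]`. -/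
def derOp {n : ℕ} (i : Fin n) : Module.End ℂ (Rp n) :=
  (MvPolynomial.pderiv i).toLinearMap

/-- The `n`-th Weyl algebra `Dₙ`, realized concretely as the `ℂ`-subalgebra of the
`ℂ`-linear endomorphisms of `ℂ[x₁,…,xₙ]` generated by the multiplication
operators `x₁,…,xₙ` and the partial derivative operators `∂₁,…,∂ₙ`. -/
def Weyl (n : ℕ) : Subalgebra ℂ (Module.End ℂ (Rp n)) :=
  Algebra.adjoin ℂ (Set.range (mulOp (n := n)) ∪ Set.range (derOp (n := n)))

/-- The element `xᵢ` of the Weyl algebra. -/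
def wx {n : ℕ} (i : Fin n) : Weyl n :=
  ⟨mulOp i, Algebra.subset_adjoin (Or.inl ⟨i, rfl⟩)⟩

/-- The element `∂ᵢ` of the Weyl algebra. -/
def wd {n : ℕ} (i : Fin n) : Weyl n :=
  ⟨derOp i, Algebra.subset_adjoin (Or.inr ⟨i, rfl⟩)⟩

instance (priority := 10000) weylRing (n : ℕ) : Ring ↥(Weyl n) :=
  inferInstanceAs (Ring ↥(Weyl n).toSubring)

instance (priority := 10000) weylAddCommGroup (n : ℕ) : AddCommGroup ↥(Weyl n) :=
  (weylRing n).toAddCommGroup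

instance (priority := 10000) weylModC (n : ℕ) : Module ℂ ↥(Weyl n) :=
  inferInstance

instance (priority := 10000) weylAlgebra (n : ℕ) : Algebra ℂ ↥(Weyl n) :=
  inferInstance

/-- The monomial `x^α ∂^β` in the Weyl algebra. -/
def wmono {n : ℕ} (α β : Fin n → ℕ) : Weyl n :=
  (List.ofFn fun i : Fin n => (wx i) ^ (α i)).prod *
    (List.ofFn fun i : Fin n => (wd i) ^ (β i)).prod

/-- The `V_d`-filtration `F^j(Dₙ)`: the `ℂ`-span of the monomials `x^α ∂^β`
with `|β_H| ≤ |α_H| + j`, where `|γ_H| = γ₁ + … + γ_d`. -/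
def Vfil (n d : ℕ) (j : ℤ) : Submodule ℂ (Weyl n) :=
  Submodule.span ℂ { w | ∃ α β : Fin n → ℕ,
    w = wmono α β ∧
    (∑ i : Fin n, if (i : ℕ) < d then (β i : ℤ) else 0) ≤
      (∑ i : Fin n, if (i : ℕ) < d then (α i : ℤ) else 0) + j }

/-- The shifted `V_d`-filtration `F^j[𝔪](A) = Σᵢ F^{j-𝔪(i)}(Dₙ)·eᵢ` on the free
module `A = Dₙ^m` with shift vector `𝔪`, as a set. -/
def VfilFree (n d : ℕ) {m : ℕ} (𝔪 : Fin m → ℤ) (j : ℤ) : Set (Fin m → Weyl n) :=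
  { v | ∀ i, v i ∈ Vfil n d (j - 𝔪 i) }

/-! ### A noncommutative Hilbert basis theorem -/

section HilbertBasis

variable {B A : Type*} [Ring B] [Ring A]

/-- `IsPolyLT φ x k a` says that `a` is a left polynomial `∑_{i<k} φ(bᵢ) xⁱ` of degree `< k`. -/
def IsPolyLT (φ : B →+* A) (x : A) : ℕ → A → Prop
  | 0, a => a = 0
  | k + 1, a => ∃ b p, IsPolyLT φ x k p ∧ a = φ b * x ^ k + p

variable {φ : B →+* A} {x : A}

lemma IsPolyLT.zero (k : ℕ) : IsPolyLT φ x k 0 := by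
  induction k with
  | zero => rfl
  | succ k ih => exact ⟨0, 0, ih, by simp⟩

lemma IsPolyLT.add {k : ℕ} {a b : A} (ha : IsPolyLT φ x k a) (hb : IsPolyLT φ x k b) :
    IsPolyLT φ x k (a + b) := by
  induction k generalizing a b with
  | zero => simp_all [IsPolyLT]
  | succ k ih =>
    obtain ⟨c, p, hp, rfl⟩ := ha
    obtain ⟨c', p', hp', rfl⟩ := hb
    exact ⟨c + c', p + p', ih hp hp', by rw [map_add, add_mul]; abel⟩

lemma IsPolyLT.map_mul {k : ℕ} {a : A} (b : B) (ha : IsPolyLT φ x k a) :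
    IsPolyLT φ x k (φ b * a) := by
  induction k generalizing a with
  | zero => simp_all [IsPolyLT]
  | succ k ih =>
    obtain ⟨c, p, hp, rfl⟩ := ha
    exact ⟨b * c, φ b * p, ih hp, by rw [_root_.map_mul, mul_add, mul_assoc]⟩

lemma IsPolyLT.sub {k : ℕ} {a b : A} (ha : IsPolyLT φ x k a) (hb : IsPolyLT φ x k b) :
    IsPolyLT φ x k (a - b) := by
  simpa [sub_eq_add_neg] using ha.add (hb.map_mul (-1))

lemma IsPolyLT.succ {k : ℕ} {a : A} (ha : IsPolyLT φ x k a) : IsPolyLT φ x (k + 1) a :=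
  ⟨0, a, ha, by simp⟩

lemma IsPolyLT.mono {k l : ℕ} (hkl : k ≤ l) {a : A} (ha : IsPolyLT φ x k a) :
    IsPolyLT φ x l a := by
  induction hkl with
  | refl => exact ha
  | step _ ih => exact ih.succ

lemma IsPolyLT.var_mul (hx : ∀ b, ∃ b', x * φ b = φ b * x + φ b') {k : ℕ} {a : A}
    (ha : IsPolyLT φ x k a) : IsPolyLT φ x (k + 1) (x * a) := by
  induction k generalizing a with
  | zero =>
    obtain rfl : a = 0 := ha
    simpa using IsPolyLT.zero 1
  | succ k ih =>
    obtain ⟨c, p, hp, rfl⟩ := ha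
    obtain ⟨c', hc'⟩ := hx c
    refine ⟨c, φ c' * x ^ k + x * p, ?_, ?_⟩
    · exact IsPolyLT.add ⟨c', 0, .zero k, by simp⟩ (ih hp)
    · rw [mul_add, ← mul_assoc, hc', add_mul, mul_assoc, ← pow_succ', add_assoc]

lemma exists_isPolyLT (hx : ∀ b, ∃ b', x * φ b = φ b * x + φ b')
    (hgen : Subring.closure (Set.range φ ∪ {x}) = ⊤) (a : A) : ∃ k, IsPolyLT φ x k a := by
  have key : ∀ t, (∃ k, IsPolyLT φ x k t) → ∃ k, IsPolyLT φ x k (a * t) := by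
    have ha : a ∈ Subring.closure (Set.range φ ∪ {x}) := hgen ▸ Subring.mem_top a
    induction ha using Subring.closure_induction with
    | mem y hy =>
      rintro t ⟨k, hk⟩
      rcases hy with ⟨b, rfl⟩ | rfl
      · exact ⟨k, hk.map_mul b⟩
      · exact ⟨k + 1, hk.var_mul hx⟩
    | zero => exact fun t _ => ⟨0, by simp [IsPolyLT]⟩
    | one => exact fun t ht => by simpa using ht
    | add y z _ _ hy hz =>
      intro t ht
      obtain ⟨k, hk⟩ := hy t ht
      obtain ⟨l, hl⟩ := hz t ht
      exact ⟨max k l, by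
        simpa [add_mul] using (hk.mono (le_max_left k l)).add (hl.mono (le_max_right k l))⟩
    | neg y _ hy =>
      intro t ht
      obtain ⟨k, hk⟩ := hy t ht
      exact ⟨k, by simpa using hk.map_mul (-1)⟩
    | mul y z _ _ hy hz =>
      intro t ht
      simpa [mul_assoc] using hy _ (hz t ht)
  simpa using key 1 ⟨1, 1, 0, rfl, by simp⟩

/-- The left ideal of leading coefficients of the elements of `I` of degree at most `k`. -/
def leadingCoeffIdeal (φ : B →+* A) (x : A) (k : ℕ) (I : Submodule A A) : Submodule B B where
  carrier := {b | ∃ p, IsPolyLT φ x k p ∧ φ b * x ^ k + p ∈ I}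
  zero_mem' := ⟨0, .zero k, by simp⟩
  add_mem' := by
    rintro a b ⟨p, hp, hpI⟩ ⟨q, hq, hqI⟩
    refine ⟨p + q, hp.add hq, ?_⟩
    convert I.add_mem hpI hqI using 1
    rw [map_add, add_mul]
    abel
  smul_mem' := by
    rintro c b ⟨p, hp, hpI⟩
    refine ⟨φ c * p, hp.map_mul c, ?_⟩
    convert I.smul_mem (φ c) hpI using 1
    rw [smul_eq_mul, smul_eq_mul, map_mul, mul_add, mul_assoc]

lemma leadingCoeffIdeal_mono {k : ℕ} {I J : Submodule A A} (h : I ≤ J) :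
    leadingCoeffIdeal φ x k I ≤ leadingCoeffIdeal φ x k J :=
  fun _ ⟨p, hp, hpI⟩ => ⟨p, hp, h hpI⟩

lemma leadingCoeffIdeal_le_succ (hx : ∀ b, ∃ b', x * φ b = φ b * x + φ b') (k : ℕ)
    (I : Submodule A A) : leadingCoeffIdeal φ x k I ≤ leadingCoeffIdeal φ x (k + 1) I := by
  rintro b ⟨p, hp, hpI⟩
  obtain ⟨b', hb'⟩ := hx b
  refine ⟨φ b' * x ^ k + x * p, ?_, ?_⟩
  · exact IsPolyLT.add ⟨b', 0, .zero k, by simp⟩ (hp.var_mul hx)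
  · convert I.smul_mem x hpI using 1
    rw [smul_eq_mul, mul_add, ← mul_assoc, hb', add_mul, pow_succ', mul_assoc, add_assoc]

lemma le_of_leadingCoeffIdeal_le (hx : ∀ b, ∃ b', x * φ b = φ b * x + φ b')
    (hgen : Subring.closure (Set.range φ ∪ {x}) = ⊤) {I J : Submodule A A} (hIJ : I ≤ J)
    (h : ∀ k, leadingCoeffIdeal φ x k J ≤ leadingCoeffIdeal φ x k I) : J ≤ I := by
  have key : ∀ k a, IsPolyLT φ x k a → a ∈ J → a ∈ I := by
    intro k
    induction k with
    | zero =>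
      rintro a rfl -
      exact I.zero_mem
    | succ k ih =>
      rintro a ⟨b, p, hp, rfl⟩ haJ
      obtain ⟨q, hq, hqI⟩ := h k ⟨p, hp, haJ⟩
      have hpq := ih (p - q) (hp.sub hq) (by convert J.sub_mem haJ (hIJ hqI) using 1; abel)
      convert I.add_mem hqI hpq using 1
      abel
  intro a ha
  obtain ⟨k, hk⟩ := exists_isPolyLT hx hgen a
  exact key k a hk ha

lemma exists_stable_of_monotone₂ {α : Type*} [PartialOrder α] [WellFoundedGT α]
    (f : ℕ → ℕ → α) (h₁ : ∀ i, Monotone fun k => f k i) (h₂ : ∀ k, Monotone (f k)) :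
    ∃ N, ∀ i, N ≤ i → ∀ k, f k i = f k N := by
  obtain ⟨M, hM⟩ := WellFoundedGT.monotone_chain_condition
    (⟨fun i => f i i, fun i j hij => (h₁ i hij).trans (h₂ j hij)⟩ : ℕ →o α)
  have row : ∀ k, ∃ N, ∀ i, N ≤ i → f k N = f k i := fun k =>
    WellFoundedGT.monotone_chain_condition (⟨f k, h₂ k⟩ : ℕ →o α)
  choose R hR using row
  have diag : ∀ k i, M ≤ k → M ≤ i → f k i = f M M := by
    intro k i hk hi
    apply le_antisymm
    · calc f k i ≤ f (max k i) i := h₁ i (le_max_left k i)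
        _ ≤ f (max k i) (max k i) := h₂ _ (le_max_right k i)
        _ = f M M := (hM (max k i) (hk.trans (le_max_left k i))).symm
    · exact (h₁ M hk).trans (h₂ k hi)
  let N := max M ((Finset.range M).sup R)
  refine ⟨N, fun i hi k => ?_⟩
  have hMN : M ≤ N := le_max_left _ _
  rcases le_or_gt M k with hk | hk
  · rw [diag k i hk (hMN.trans hi), diag k N hk hMN]
  · have hRN : R k ≤ N :=
      (Finset.le_sup (f := R) (Finset.mem_range.2 hk)).trans (le_max_right _ _)
    rw [← hR k i (hRN.trans hi), ← hR k N hRN]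

/-- Noncommutative Hilbert basis theorem: a ring generated by the image of a left Noetherian ring
`B` and an element `x` whose commutators with `B` lie in the image of `B` is left Noetherian. -/
theorem isNoetherianRing_of_ore_generator [IsNoetherianRing B]
    (hx : ∀ b, ∃ b', x * φ b = φ b * x + φ b')
    (hgen : Subring.closure (Set.range φ ∪ {x}) = ⊤) : IsNoetherianRing A := by
  refine monotone_stabilizes_iff_noetherian.1 fun I => ?_
  obtain ⟨N, hN⟩ := exists_stable_of_monotone₂ (fun k i => leadingCoeffIdeal φ x k (I i))
    (fun i => monotone_nat_of_le_succ fun k => leadingCoeffIdeal_le_succ hx k (I i))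
    (fun k i j hij => leadingCoeffIdeal_mono (I.monotone hij))
  exact ⟨N, fun i hi => le_antisymm (I.monotone hi)
    (le_of_leadingCoeffIdeal_le hx hgen (I.monotone hi) fun k => (hN i hi k).le)⟩

end HilbertBasis

/-- A subalgebra generated by a finite list of elements whose commutators are scalars is left
Noetherian. -/
theorem isNoetherianRing_adjoin_list {k A : Type*} [CommRing k] [IsNoetherianRing k] [Ring A]
    [Algebra k A] (l : List A)
    (hl : l.Pairwise fun x y => ∃ c : k, x * y = y * x + algebraMap k A c) :
    IsNoetherianRing (Algebra.adjoin k {a | a ∈ l}) := by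
  induction l with
  | nil =>
    have hs : Function.Surjective
        (algebraMap k (Algebra.adjoin k {a : A | a ∈ ([] : List A)})) := by
      rintro ⟨a, ha⟩
      have ha' : a ∈ (⊥ : Subalgebra k A) := by simpa using ha
      obtain ⟨c, rfl⟩ := Algebra.mem_bot.1 ha'
      exact ⟨c, rfl⟩
    exact isNoetherianRing_of_surjective _ _ _ hs
  | cons x l ih =>
    rw [List.pairwise_cons] at hl
    have := ih hl.2
    have hle : Algebra.adjoin k {a | a ∈ l} ≤ Algebra.adjoin k {a | a ∈ x :: l} :=
      Algebra.adjoin_mono fun a ha => List.mem_cons_of_mem x ha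
    have hxm : x ∈ Algebra.adjoin k {a | a ∈ x :: l} :=
      Algebra.subset_adjoin (List.mem_cons_self)
    let φ := (Subalgebra.inclusion hle).toRingHom
    have hcomm : ∀ b ∈ Algebra.adjoin k {a | a ∈ l},
        ∃ b' ∈ Algebra.adjoin k {a | a ∈ l}, x * b = b * x + b' := by
      intro b hb
      induction hb using Algebra.adjoin_induction with
      | mem y hy =>
        obtain ⟨c, hc⟩ := hl.1 y hy
        exact ⟨_, Subalgebra.algebraMap_mem _ c, hc⟩
      | algebraMap r => exact ⟨0, zero_mem _, by rw [add_zero, Algebra.commutes]⟩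
      | add y z _ _ hy hz =>
        obtain ⟨y', hy', ey⟩ := hy
        obtain ⟨z', hz', ez⟩ := hz
        exact ⟨y' + z', add_mem hy' hz', by rw [mul_add, ey, ez, add_mul]; abel⟩
      | mul y z hy₀ hz₀ hy hz =>
        obtain ⟨y', hy', ey⟩ := hy
        obtain ⟨z', hz', ez⟩ := hz
        refine ⟨y * z' + y' * z, add_mem (mul_mem hy₀ hz') (mul_mem hy' hz₀), ?_⟩
        rw [← mul_assoc, ey, add_mul, mul_assoc y x z, ez, mul_add, mul_assoc, add_assoc]
    refine isNoetherianRing_of_ore_generator (φ := φ) (x := ⟨x, hxm⟩) ?_ ?_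
    · rintro ⟨b, hb⟩
      obtain ⟨b', hb', e⟩ := hcomm b hb
      exact ⟨⟨b', hb'⟩, Subtype.ext e⟩
    · rw [eq_top_iff]
      rintro ⟨a, ha⟩ -
      induction ha using Algebra.adjoin_induction with
      | mem y hy =>
        apply Subring.subset_closure
        rcases List.mem_cons.1 hy with rfl | hy
        · exact Or.inr rfl
        · exact Or.inl ⟨⟨y, Algebra.subset_adjoin hy⟩, rfl⟩
      | algebraMap r =>
        exact Subring.subset_closure
          (Or.inl ⟨algebraMap k (Algebra.adjoin k {a | a ∈ l}) r, rfl⟩)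
      | add y z hy hz ihy ihz => exact add_mem ihy ihz
      | mul y z hy hz ihy ihz => exact mul_mem ihy ihz

/-! ### Uniform bounds over a Noetherian Rees ring -/

section Rees

variable {W : Type*} [Ring W]

lemma coeff_mul_eq_sum (a b : AddMonoidAlgebra W ℤ) (j : ℤ) :
    (a * b).coeff j = ∑ s ∈ a.coeff.support, a.coeff s * b.coeff (j - s) := by
  change _ = a.coeff.sum fun s c => c * b.coeff (j - s)
  induction a using AddMonoidAlgebra.induction_linear with
  | zero => simp
  | add a a' ha ha' =>
    rw [add_mul, AddMonoidAlgebra.coeff_add, AddMonoidAlgebra.coeff_add, Finsupp.add_apply,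
      ha, ha', Finsupp.sum_add_index'] <;> simp [add_mul]
  | single s c =>
    rw [AddMonoidAlgebra.coeff_single, Finsupp.sum_single_index (by simp)]
    exact AddMonoidAlgebra.coeff_single_mul_eq_mul_coeff _ (fun m' _ => by omega)

variable {m : ℕ}

/-- The degree `j` component of a vector of Laurent polynomials, for the shift vector `𝔪`. -/
def shiftedCoeff (𝔪 : Fin m → ℤ) (g : Fin m → AddMonoidAlgebra W ℤ) (j : ℤ) : Fin m → W :=
  fun i => (g i).coeff (j - 𝔪 i)

/-- The Rees submodule associated with a filtration `H` of a free module. -/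
def reesSubmodule (S : Subring (AddMonoidAlgebra W ℤ)) (V : ℤ → Set W)
    (hS : ∀ a ∈ S, ∀ j, a.coeff j ∈ V j) (𝔪 : Fin m → ℤ) (H : ℤ → AddSubgroup (Fin m → W))
    (hH : ∀ i j, ∀ a ∈ V i, ∀ w ∈ H j, a • w ∈ H (i + j)) : Submodule S (Fin m → S) where
  carrier := {g | ∀ j, shiftedCoeff 𝔪 (fun i => (g i : AddMonoidAlgebra W ℤ)) j ∈ H j}
  zero_mem' := fun j => (H j).zero_mem
  add_mem' := fun hf hg j => (H j).add_mem (hf j) (hg j)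
  smul_mem' := by
    intro a g hg j
    have : shiftedCoeff 𝔪 (fun i => ((a • g) i : AddMonoidAlgebra W ℤ)) j =
        ∑ s ∈ a.1.coeff.support,
          a.1.coeff s • shiftedCoeff 𝔪 (fun i => (g i : AddMonoidAlgebra W ℤ)) (j - s) := by
      funext i
      simp only [shiftedCoeff, Finset.sum_apply, Pi.smul_apply, smul_eq_mul, Subring.coe_mul]
      rw [coeff_mul_eq_sum]
      exact Finset.sum_congr rfl fun s _ => by rw [sub_right_comm]
    rw [this]
    refine (H j).sum_mem fun s _ => ?_
    simpa using hH s (j - s) _ (hS a a.2 s) _ (hg (j - s))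

/-- If the Rees ring of `(W, V)` is left Noetherian, then an increasing sequence of filtrations
on a free module stabilizes uniformly on all levels. -/
theorem exists_uniform_bound (S : Subring (AddMonoidAlgebra W ℤ)) [IsNoetherianRing S]
    (V : ℤ → Set W) (hS : ∀ a ∈ S, ∀ j, a.coeff j ∈ V j)
    (hS' : ∀ j, ∀ w ∈ V j, AddMonoidAlgebra.single j w ∈ S) (𝔪 : Fin m → ℤ)
    (H : ℕ → ℤ → AddSubgroup (Fin m → W)) (hmono : ∀ j, Monotone fun c => H c j)
    (hH : ∀ c i j, ∀ a ∈ V i, ∀ w ∈ H c j, a • w ∈ H c (i + j)) :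
    ∃ c, ∀ c' j w, (∀ i, w i ∈ V (j - 𝔪 i)) → w ∈ H c' j → w ∈ H c j := by
  let f : ℕ →o Submodule S (Fin m → S) :=
    ⟨fun c => reesSubmodule S V hS 𝔪 (H c) (hH c), fun c c' hcc g hg j => hmono j hcc (hg j)⟩
  obtain ⟨c, hc⟩ := monotone_stabilizes_iff_noetherian.2 (inferInstance : IsNoetherian S _) f
  refine ⟨c, fun c' j w hw hwH => ?_⟩
  let g : Fin m → S := fun i => ⟨AddMonoidAlgebra.single (j - 𝔪 i) (w i), hS' _ _ (hw i)⟩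
  have hgj : shiftedCoeff 𝔪 (fun i => (g i : AddMonoidAlgebra W ℤ)) j = w := by
    funext i
    simp only [shiftedCoeff, g, AddMonoidAlgebra.coeff_single, Finsupp.single_eq_same]
  have hg' : g ∈ f c' := by
    intro j'
    rcases eq_or_ne j j' with rfl | hj
    · rwa [hgj]
    · convert (H c' j').zero_mem using 1
      funext i
      have : j - 𝔪 i ≠ j' - 𝔪 i := by omega
      simp only [shiftedCoeff, g, AddMonoidAlgebra.coeff_single, Finsupp.single_apply, if_neg this,
        Pi.zero_apply]
  have hg : g ∈ f c := by
    rw [hc _ (le_max_left c c')]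
    exact f.monotone (le_max_right c c') hg'
  simpa [hgj] using hg j

end Rees

/-! ### The `V_d`-filtration of the Weyl algebra -/

lemma mul_prod_ofFn_pow {M : Type*} [Monoid M] {n : ℕ} (f : Fin n → M)
    (hf : ∀ i j, Commute (f i) (f j)) (k : Fin n) (a : Fin n → ℕ) :
    f k * (List.ofFn fun i => f i ^ a i).prod =
      (List.ofFn fun i => f i ^ (a + Pi.single k 1 : Fin n → ℕ) i).prod := by
  induction n with
  | zero => exact k.elim0
  | succ n ih =>
    rw [List.ofFn_succ, List.ofFn_succ, List.prod_cons, List.prod_cons]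
    cases k using Fin.cases with
    | zero => simp [pow_succ', mul_assoc]
    | succ k =>
      have := ih (fun i => f i.succ) (fun i j => hf _ _) k (fun i => a i.succ)
      rw [← mul_assoc, ((hf k.succ 0).pow_right (a 0)).eq, mul_assoc, this]
      simp [Pi.single_apply]

lemma prod_ofFn_pow_induction {M : Type*} [Monoid M] {n : ℕ} (P : ℤ → M → Prop) (one : P 0 1)
    (mul : ∀ i j a b, P i a → P j b → P (i + j) (a * b)) (f : Fin n → M) (e : Fin n → ℤ)
    (hf : ∀ i, P (e i) (f i)) (a : Fin n → ℕ) :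
    P (∑ i, a i * e i) (List.ofFn fun i => f i ^ a i).prod := by
  have hpow : ∀ i k, P ((k : ℕ) * e i) (f i ^ k) := by
    intro i k
    induction k with
    | zero => simpa using one
    | succ k ih =>
      rw [pow_succ]
      convert mul _ _ _ _ ih (hf i) using 1
      push_cast
      ring
  induction n with
  | zero => simpa using one
  | succ n ih =>
    rw [List.ofFn_succ, List.prod_cons, Fin.sum_univ_succ]
    exact mul _ _ _ _ (hpow 0 _) (ih _ _ (fun i => hf _) _ (fun i => hpow _))

section WeylFiltration

variable {n : ℕ}

lemma wx_commute (i j : Fin n) : Commute (wx i) (wx j) := by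
  apply Subtype.ext
  refine LinearMap.ext fun p => ?_
  change (MvPolynomial.X i * (MvPolynomial.X j * p) : Rp n) =
    MvPolynomial.X j * (MvPolynomial.X i * p)
  ring

lemma wd_commute (i j : Fin n) : Commute (wd i) (wd j) := by
  apply Subtype.ext
  refine LinearMap.ext fun p => ?_
  change MvPolynomial.pderiv i (MvPolynomial.pderiv j p) =
    MvPolynomial.pderiv j (MvPolynomial.pderiv i p)
  have : ⁅(MvPolynomial.pderiv i : Derivation ℂ (Rp n) (Rp n)),
      (MvPolynomial.pderiv j : Derivation ℂ (Rp n) (Rp n))⁆ = 0 := by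
    refine MvPolynomial.derivation_ext fun k => ?_
    simp [Derivation.commutator_apply, MvPolynomial.pderiv_X, Pi.single_apply, apply_ite]
  simpa [Derivation.commutator_apply, sub_eq_zero] using congr($this p)

lemma coe_weyl_mul (a b : Weyl n) : ((a * b : Weyl n) : Module.End ℂ (Rp n)) = a * b := rfl

lemma coe_weyl_add (a b : Weyl n) : ((a + b : Weyl n) : Module.End ℂ (Rp n)) = a + b := rfl

lemma coe_weyl_one : ((1 : Weyl n) : Module.End ℂ (Rp n)) = 1 := rfl

lemma coe_wx_apply (i : Fin n) (p : Rp n) :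
    (wx i : Module.End ℂ (Rp n)) p = MvPolynomial.X i * p := rfl

lemma coe_wd_apply (i : Fin n) (p : Rp n) :
    (wd i : Module.End ℂ (Rp n)) p = MvPolynomial.pderiv i p := rfl

lemma wd_mul_wx_of_ne {i j : Fin n} (h : i ≠ j) : wd i * wx j = wx j * wd i := by
  refine Subtype.ext (LinearMap.ext fun p => ?_)
  rw [coe_weyl_mul, coe_weyl_mul, Module.End.mul_apply, Module.End.mul_apply, coe_wx_apply,
    coe_wx_apply, coe_wd_apply, coe_wd_apply, Derivation.leibniz,
    MvPolynomial.pderiv_X_of_ne h.symm, smul_zero, add_zero, smul_eq_mul]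

lemma wd_mul_wx_self (i : Fin n) : wd i * wx i = wx i * wd i + 1 := by
  refine Subtype.ext (LinearMap.ext fun p => ?_)
  rw [coe_weyl_add, LinearMap.add_apply, coe_weyl_mul, coe_weyl_mul, Module.End.mul_apply,
    Module.End.mul_apply, coe_wx_apply, coe_wx_apply, coe_wd_apply, coe_wd_apply, coe_weyl_one,
    Module.End.one_apply, Derivation.leibniz, MvPolynomial.pderiv_X_self, smul_eq_mul,
    smul_eq_mul, mul_one]

lemma wd_mul_wx (i j : Fin n) : wd i * wx j = wx j * wd i + if i = j then 1 else 0 := by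
  split_ifs with h
  · rw [h, wd_mul_wx_self]
  · rw [add_zero, wd_mul_wx_of_ne h]

/-- The weight of the `i`-th coordinate: `1` if it is among the first `d`, and `0` otherwise. -/
def weight (d : ℕ) (i : Fin n) : ℤ := if (i : ℕ) < d then 1 else 0

lemma sum_mul_weight (d : ℕ) (a : Fin n → ℕ) :
    ∑ i, (a i : ℤ) * weight d i = ∑ i : Fin n, if (i : ℕ) < d then (a i : ℤ) else 0 := by
  simp [weight]

lemma wmono_mem_Vfil {d : ℕ} {α β : Fin n → ℕ} {j : ℤ}
    (h : ∑ i, (β i : ℤ) * weight d i ≤ ∑ i, (α i : ℤ) * weight d i + j) :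
    wmono α β ∈ Vfil n d j := by
  rw [sum_mul_weight, sum_mul_weight] at h
  exact Submodule.subset_span ⟨α, β, rfl, h⟩

lemma Vfil_induction {d : ℕ} {j : ℤ} {P : Submodule ℂ (Weyl n)}
    (h : ∀ α β : Fin n → ℕ,
      ∑ i, (β i : ℤ) * weight d i ≤ ∑ i, (α i : ℤ) * weight d i + j → wmono α β ∈ P) :
    Vfil n d j ≤ P := by
  refine Submodule.span_le.2 ?_
  rintro _ ⟨α, β, rfl, hαβ⟩
  refine h α β ?_
  rwa [sum_mul_weight, sum_mul_weight]

lemma Vfil_mono {d : ℕ} : Monotone (Vfil n d) :=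
  fun _ _ h => Vfil_induction fun _ _ hαβ => wmono_mem_Vfil (by omega)

lemma one_mem_Vfil (d : ℕ) : (1 : Weyl n) ∈ Vfil n d 0 := by
  have h : wmono (0 : Fin n → ℕ) 0 = 1 := by simp [wmono]
  exact h ▸ wmono_mem_Vfil (by simp)

lemma sum_add_single_mul_weight (d : ℕ) (a : Fin n → ℕ) (k : Fin n) :
    ∑ i, ((a + Pi.single k 1 : Fin n → ℕ) i : ℤ) * weight d i =
      ∑ i, (a i : ℤ) * weight d i + weight d k := by
  simp [add_mul, Finset.sum_add_distrib, Pi.single_apply]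

lemma wx_mul_wmono (k : Fin n) (α β : Fin n → ℕ) :
    wx k * wmono α β = wmono (α + Pi.single k 1) β := by
  rw [wmono, wmono, ← mul_assoc, mul_prod_ofFn_pow _ wx_commute]

lemma wx_mul_mem_Vfil {d : ℕ} (k : Fin n) {j : ℤ} {w : Weyl n} (hw : w ∈ Vfil n d j) :
    wx k * w ∈ Vfil n d (-weight d k + j) := by
  have : Vfil n d j ≤ (Vfil n d (-weight d k + j)).comap (LinearMap.mulLeft ℂ (wx k)) := by
    refine Vfil_induction fun α β h => ?_
    rw [Submodule.mem_comap, LinearMap.mulLeft_apply, wx_mul_wmono]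
    apply wmono_mem_Vfil
    rw [sum_add_single_mul_weight]
    omega
  exact this hw

lemma wd_mul_wmono_mem_Vfil {d : ℕ} (k : Fin n) (α β : Fin n → ℕ) (j : ℤ)
    (h : ∑ i, (β i : ℤ) * weight d i ≤ ∑ i, (α i : ℤ) * weight d i + j) :
    wd k * wmono α β ∈ Vfil n d (weight d k + j) := by
  induction hs : ∑ i, α i generalizing α j with
  | zero =>
    obtain rfl : α = 0 := by
      funext i
      exact (Finset.sum_eq_zero_iff.1 hs) i (Finset.mem_univ i)
    have : wd k * wmono 0 β = wmono 0 (β + Pi.single k 1) := by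
      simpa [wmono] using mul_prod_ofFn_pow _ wd_commute k β
    rw [this]
    apply wmono_mem_Vfil
    rw [sum_add_single_mul_weight]
    omega
  | succ N ih =>
    obtain ⟨i, -, hi⟩ : ∃ i ∈ Finset.univ, α i ≠ 0 :=
      Finset.exists_ne_zero_of_sum_ne_zero (by omega)
    obtain ⟨α', rfl⟩ : ∃ α', α = α' + Pi.single i 1 := by
      refine ⟨α - Pi.single i 1, (tsub_add_cancel_of_le ?_).symm⟩
      intro l
      rcases eq_or_ne l i with rfl | hl
      · simpa using Nat.one_le_iff_ne_zero.2 hi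
      · simp [hl]
    rw [sum_add_single_mul_weight] at h
    have hs' : ∑ l, α' l = N := by
      simpa [Finset.sum_add_distrib] using hs
    rw [← wx_mul_wmono, ← mul_assoc, wd_mul_wx, add_mul, mul_assoc]
    refine add_mem ?_ ?_
    · convert wx_mul_mem_Vfil i (ih α' (weight d i + j) (by omega) hs') using 1
      ring_nf
    · split_ifs with hki
      · subst hki
        rw [one_mul]
        exact wmono_mem_Vfil (by omega)
      · rw [zero_mul]
        exact zero_mem _

lemma wd_mul_mem_Vfil {d : ℕ} (k : Fin n) {j : ℤ} {w : Weyl n} (hw : w ∈ Vfil n d j) :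
    wd k * w ∈ Vfil n d (weight d k + j) := by
  have : Vfil n d j ≤ (Vfil n d (weight d k + j)).comap (LinearMap.mulLeft ℂ (wd k)) :=
    Vfil_induction fun α β h => wd_mul_wmono_mem_Vfil k α β j h
  exact this hw

lemma wx_mem_Vfil (d : ℕ) (k : Fin n) : wx k ∈ Vfil n d (-weight d k) := by
  simpa using wx_mul_mem_Vfil k (one_mem_Vfil d)

lemma wd_mem_Vfil (d : ℕ) (k : Fin n) : wd k ∈ Vfil n d (weight d k) := by
  simpa using wd_mul_mem_Vfil k (one_mem_Vfil d)

lemma wmono_induction {d : ℕ} (P : ℤ → Weyl n → Prop) (one : P 0 1)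
    (mul : ∀ i j a b, P i a → P j b → P (i + j) (a * b))
    (x : ∀ k, P (-weight d k) (wx k)) (y : ∀ k, P (weight d k) (wd k)) (α β : Fin n → ℕ) :
    P (∑ i, (β i : ℤ) * weight d i - ∑ i, (α i : ℤ) * weight d i) (wmono α β) := by
  convert mul _ _ _ _ (prod_ofFn_pow_induction P one mul wx _ x α)
    (prod_ofFn_pow_induction P one mul wd _ y β) using 1
  swap
  · rfl
  simp only [mul_neg, Finset.sum_neg_distrib]
  ring

lemma mul_mem_Vfil {d : ℕ} {i j : ℤ} {a b : Weyl n} (ha : a ∈ Vfil n d i)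
    (hb : b ∈ Vfil n d j) : a * b ∈ Vfil n d (i + j) := by
  have : Vfil n d i ≤ (Vfil n d (i + j)).comap (LinearMap.mulRight ℂ b) := by
    refine Vfil_induction fun α β h => ?_
    have key := wmono_induction (d := d)
      (fun e w => ∀ j, ∀ v ∈ Vfil n d j, w * v ∈ Vfil n d (e + j))
      (fun j v hv => by simpa using hv)
      (fun e e' a a' ha ha' j v hv => by
        rw [mul_assoc, add_assoc]
        exact ha _ _ (ha' _ _ hv))
      (fun k j v hv => wx_mul_mem_Vfil k hv) (fun k j v hv => wd_mul_mem_Vfil k hv) α β j b hb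
    exact Vfil_mono (by omega) key
  exact this ha

lemma exists_mem_Vfil (d : ℕ) (w : Weyl n) : ∃ j, w ∈ Vfil n d j := by
  have key : ∀ a ∈ Weyl n, ∃ j, ∃ v ∈ Vfil n d j, (v : Module.End ℂ (Rp n)) = a := by
    intro a ha
    induction ha using Algebra.adjoin_induction with
    | mem a ha =>
      rcases ha with ⟨i, rfl⟩ | ⟨i, rfl⟩
      · exact ⟨_, _, wx_mem_Vfil d i, rfl⟩
      · exact ⟨_, _, wd_mem_Vfil d i, rfl⟩
    | algebraMap r =>
      exact ⟨0, r • 1, (Vfil n d 0).smul_mem r (one_mem_Vfil d),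
        (Algebra.algebraMap_eq_smul_one r).symm⟩
    | add a b _ _ iha ihb =>
      obtain ⟨i, v, hv, rfl⟩ := iha
      obtain ⟨j, w, hw, rfl⟩ := ihb
      exact ⟨max i j, v + w, add_mem (Vfil_mono (le_max_left i j) hv)
        (Vfil_mono (le_max_right i j) hw), coe_weyl_add v w⟩
    | mul a b _ _ iha ihb =>
      obtain ⟨i, v, hv, rfl⟩ := iha
      obtain ⟨j, w, hw, rfl⟩ := ihb
      exact ⟨i + j, v * w, mul_mem_Vfil hv hw, coe_weyl_mul v w⟩
  obtain ⟨j, v, hv, e⟩ := key w w.2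
  exact ⟨j, Subtype.ext e ▸ hv⟩

/-- Homogeneous generators of the Rees ring of the `V_d`-filtration. -/
def reesGenerators (n d : ℕ) : List (AddMonoidAlgebra (Weyl n) ℤ) :=
  AddMonoidAlgebra.single 1 1 ::
    (List.ofFn (fun i : Fin n => AddMonoidAlgebra.single (-weight d i) (wx i)) ++
      List.ofFn fun i : Fin n => AddMonoidAlgebra.single (weight d i) (wd i))

lemma mem_reesGenerators {d : ℕ} {a : AddMonoidAlgebra (Weyl n) ℤ} :
    a ∈ reesGenerators n d ↔ a = AddMonoidAlgebra.single 1 1 ∨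
      (∃ i, a = AddMonoidAlgebra.single (-weight d i) (wx i)) ∨
      ∃ i, a = AddMonoidAlgebra.single (weight d i) (wd i) := by
  simp only [reesGenerators, List.mem_cons, List.mem_append, List.mem_ofFn, eq_comm]

/-- The Rees ring of the `V_d`-filtration, as a ring of Laurent polynomials over `D_n`. -/
def reesRing (n d : ℕ) : Subalgebra ℂ (AddMonoidAlgebra (Weyl n) ℤ) :=
  Algebra.adjoin ℂ {a | a ∈ reesGenerators n d}

instance isNoetherianRing_reesRing (n d : ℕ) : IsNoetherianRing (reesRing n d) := by
  have hcomm : ∀ (i j : ℤ) (a b : Weyl n), Commute a b → ∃ c : ℂ,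
      (AddMonoidAlgebra.single i a * AddMonoidAlgebra.single j b : AddMonoidAlgebra (Weyl n) ℤ) =
        AddMonoidAlgebra.single j b * AddMonoidAlgebra.single i a + algebraMap ℂ _ c :=
    fun i j a b h => ⟨0, by
      rw [map_zero, add_zero]
      exact AddMonoidAlgebra.single_commute_single (AddCommute.all i j) h⟩
  have hdx : ∀ i j : Fin n,
      (AddMonoidAlgebra.single (weight d i) (wd i) *
        AddMonoidAlgebra.single (-weight d j) (wx j) : AddMonoidAlgebra (Weyl n) ℤ) =
      AddMonoidAlgebra.single (-weight d j) (wx j) *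
        AddMonoidAlgebra.single (weight d i) (wd i) + if i = j then 1 else 0 := by
    intro i j
    rw [AddMonoidAlgebra.single_mul_single, AddMonoidAlgebra.single_mul_single, wd_mul_wx,
      AddMonoidAlgebra.single_add, add_comm (weight d i)]
    split_ifs with h
    · subst h
      rw [neg_add_cancel, AddMonoidAlgebra.one_def]
    · rw [AddMonoidAlgebra.single_zero]
  refine isNoetherianRing_adjoin_list _ (List.pairwise_of_forall_mem_list fun a ha b hb => ?_)
  rcases mem_reesGenerators.1 ha with rfl | ⟨i, rfl⟩ | ⟨i, rfl⟩
  · rcases mem_reesGenerators.1 hb with rfl | ⟨j, rfl⟩ | ⟨j, rfl⟩ <;>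
      exact hcomm _ _ _ _ (Commute.one_left _)
  · rcases mem_reesGenerators.1 hb with rfl | ⟨j, rfl⟩ | ⟨j, rfl⟩
    · exact hcomm _ _ _ _ (Commute.one_right _)
    · exact hcomm _ _ _ _ (wx_commute i j)
    · refine ⟨if j = i then -1 else 0, ?_⟩
      rw [hdx]
      split_ifs
      · rw [map_neg, map_one, add_neg_cancel_right]
      · rw [map_zero, add_zero, add_zero]
  · rcases mem_reesGenerators.1 hb with rfl | ⟨j, rfl⟩ | ⟨j, rfl⟩
    · exact hcomm _ _ _ _ (Commute.one_right _)
    · refine ⟨if i = j then 1 else 0, ?_⟩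
      rw [hdx]
      split_ifs
      · rw [map_one]
      · rw [map_zero]
    · exact hcomm _ _ _ _ (wd_commute i j)

lemma coeff_mem_Vfil_of_mem_reesRing {d : ℕ} {a : AddMonoidAlgebra (Weyl n) ℤ}
    (ha : a ∈ reesRing n d) (j : ℤ) : a.coeff j ∈ Vfil n d j := by
  have hsingle : ∀ (i : ℤ) (w : Weyl n), w ∈ Vfil n d i → ∀ j,
      (AddMonoidAlgebra.single i w).coeff j ∈ Vfil n d j := by
    intro i w hw j
    rw [AddMonoidAlgebra.coeff_single, Finsupp.single_apply]
    split_ifs with h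
    · exact h ▸ hw
    · exact zero_mem _
  induction ha using Algebra.adjoin_induction generalizing j with
  | mem a ha =>
    rcases mem_reesGenerators.1 ha with rfl | ⟨i, rfl⟩ | ⟨i, rfl⟩
    · exact hsingle _ _ (Vfil_mono zero_le_one (one_mem_Vfil d)) j
    · exact hsingle _ _ (wx_mem_Vfil d i) j
    · exact hsingle _ _ (wd_mem_Vfil d i) j
  | algebraMap r =>
    rw [Algebra.algebraMap_eq_smul_one, AddMonoidAlgebra.one_def, AddMonoidAlgebra.coeff_smul]
    exact Submodule.smul_mem _ _ (hsingle _ _ (one_mem_Vfil d) j)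
  | add a b ha hb iha ihb => exact add_mem (iha j) (ihb j)
  | mul a b ha hb iha ihb =>
    rw [coeff_mul_eq_sum]
    refine Submodule.sum_mem _ fun s _ => ?_
    simpa using mul_mem_Vfil (iha s) (ihb (j - s))

lemma single_mem_reesRing {d : ℕ} {j : ℤ} {w : Weyl n} (hw : w ∈ Vfil n d j) :
    AddMonoidAlgebra.single j w ∈ reesRing n d := by
  have hgen : ∀ a ∈ reesGenerators n d, a ∈ reesRing n d := fun a ha => Algebra.subset_adjoin ha
  have hmul : ∀ (i j : ℤ) (a b : Weyl n), AddMonoidAlgebra.single i a ∈ reesRing n d →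
      AddMonoidAlgebra.single j b ∈ reesRing n d →
      AddMonoidAlgebra.single (i + j) (a * b) ∈ reesRing n d := fun i j a b ha hb => by
    rw [← AddMonoidAlgebra.single_mul_single]
    exact mul_mem ha hb
  have hT : ∀ k : ℕ, AddMonoidAlgebra.single (k : ℤ) (1 : Weyl n) ∈ reesRing n d := by
    intro k
    induction k with
    | zero => exact one_mem _
    | succ k ih =>
      simpa only [Nat.cast_succ, mul_one] using
        hmul _ _ _ _ ih (hgen _ (mem_reesGenerators.2 (Or.inl rfl)))
  have : Vfil n d j ≤ (Subalgebra.toSubmodule (reesRing n d)).comap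
      (AddMonoidAlgebra.lsingle (R := ℂ) j) := by
    refine Vfil_induction fun α β h => ?_
    have key := wmono_induction (d := d)
      (fun e w => AddMonoidAlgebra.single e w ∈ reesRing n d) (one_mem _) hmul
      (fun k => hgen _ (mem_reesGenerators.2 (Or.inr (Or.inl ⟨k, rfl⟩))))
      (fun k => hgen _ (mem_reesGenerators.2 (Or.inr (Or.inr ⟨k, rfl⟩)))) α β
    obtain ⟨k, hk⟩ := Int.eq_ofNat_of_zero_le
      (show 0 ≤ ∑ i, (α i : ℤ) * weight d i + j - ∑ i, (β i : ℤ) * weight d i by omega)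
    have := hmul _ _ _ _ (hT k) key
    rw [← hk, one_mul, sub_add_sub_cancel, add_sub_cancel_left] at this
    exact this
  exact this hw

/-! ### Choice of shift vectors -/

lemma zero_mem_VfilFree {d m : ℕ} (𝔪 : Fin m → ℤ) (j : ℤ) :
    (0 : Fin m → Weyl n) ∈ VfilFree n d 𝔪 j := fun _ => zero_mem _

/-- `VfilFree` as an additive subgroup. -/
def vfilFreeSubgroup (n d : ℕ) {m : ℕ} (𝔪 : Fin m → ℤ) (j : ℤ) :
    AddSubgroup (Fin m → Weyl n) where
  carrier := VfilFree n d 𝔪 j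
  zero_mem' := zero_mem_VfilFree 𝔪 j
  add_mem' := fun ha hb i => add_mem (ha i) (hb i)
  neg_mem' := fun ha i => neg_mem (ha i)

lemma smul_mem_VfilFree {d m : ℕ} {𝔪 : Fin m → ℤ} {i j : ℤ} {a : Weyl n} {v : Fin m → Weyl n}
    (ha : a ∈ Vfil n d i) (hv : v ∈ VfilFree n d 𝔪 j) : a • v ∈ VfilFree n d 𝔪 (i + j) := by
  intro k
  rw [add_sub_assoc]
  exact mul_mem_Vfil ha (hv k)

lemma VfilFree_antitone {d m : ℕ} {j : ℤ} {𝔪 𝔪' : Fin m → ℤ} (h : 𝔪' ≤ 𝔪) :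
    VfilFree n d 𝔪 j ⊆ VfilFree n d 𝔪' j :=
  fun _ hv i => Vfil_mono (sub_le_sub_left (h i) j) (hv i)

lemma exists_mem_VfilFree (d : ℕ) {m : ℕ} (j : ℤ) (v : Fin m → Weyl n) :
    ∃ c : ℕ, v ∈ VfilFree n d (fun _ => -(c : ℤ)) j := by
  choose e he using fun i => exists_mem_Vfil d (v i)
  refine ⟨Finset.univ.sup fun i => (e i - j).toNat, fun i => Vfil_mono ?_ (he i)⟩
  have : (e i - j).toNat ≤ Finset.univ.sup fun i => (e i - j).toNat :=
    Finset.le_sup (f := fun i => (e i - j).toNat) (Finset.mem_univ i)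
  dsimp only
  omega

/-- Elements of `N` of filtration level `j` whose images under `s` lift along `q` have lifts
whose levels are bounded uniformly in `j`. -/
theorem exists_uniform_lift {d m : ℕ} (𝔪 : Fin m → ℤ) {P Q : Type*}
    [AddCommGroup P] [Module (Weyl n) P] [AddCommGroup Q] [Module (Weyl n) Q]
    (N : Submodule (Weyl n) (Fin m → Weyl n)) (s : (Fin m → Weyl n) →ₗ[Weyl n] Q)
    (q : P →ₗ[Weyl n] Q) (hq : ∀ w ∈ N, ∃ p, q p = s w) (Φ : ℕ → ℤ → AddSubgroup P)
    (hmono : ∀ j, Monotone fun c => Φ c j)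
    (hsmul : ∀ c i j, ∀ a ∈ Vfil n d i, ∀ p ∈ Φ c j, a • p ∈ Φ c (i + j))
    (hex : ∀ j p, ∃ c, p ∈ Φ c j) :
    ∃ c, ∀ j, ∀ w ∈ VfilFree n d 𝔪 j, w ∈ N → ∃ p ∈ Φ c j, q p = s w := by
  have : IsNoetherianRing (reesRing n d).toSubring := isNoetherianRing_reesRing n d
  obtain ⟨c, hc⟩ := exists_uniform_bound (reesRing n d).toSubring (fun j => Vfil n d j)
    (fun a ha j => coeff_mem_Vfil_of_mem_reesRing ha j) (fun j w hw => single_mem_reesRing hw) 𝔪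
    (fun c j => N.toAddSubgroup ⊓
      ((Φ c j).map q.toAddMonoidHom).comap s.toAddMonoidHom)
    (fun j c c' hcc => inf_le_inf_left _
      (AddSubgroup.comap_mono (AddSubgroup.map_mono (hmono j hcc))))
    (by
      rintro c i j a ha w ⟨hwN, p, hp, hpw⟩
      refine ⟨N.smul_mem a hwN, a • p, hsmul c i j a ha p hp, ?_⟩
      change q p = s w at hpw
      change q (a • p) = s (a • w)
      rw [map_smul, map_smul, hpw])
  refine ⟨c, fun j w hw hwN => ?_⟩
  obtain ⟨p, hp⟩ := hq w hwN
  obtain ⟨c', hc'⟩ := hex j p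
  obtain ⟨-, p', hp', e⟩ := hc c' j w hw ⟨hwN, p, hc', hp⟩
  exact ⟨p', hp', e⟩

end WeylFiltration

/-- **Statement 7.** (Two-sequence version of the strictification lemma.)
Given short exact sequences `0 → D → A → F → 0` and `0 → A → B → C → 0` of
left `Dₙ`-modules presented by finitely generated free modules, and a shift
vector `𝔪_C` on `P_C`, one can re-present `A` as a quotient of
`Q_A = P_D ⊕ P_F` and `B` as a quotient of `Q_B = P_D ⊕ P_F ⊕ P_C`,
compatibly with all the given maps, and find shift vectors `𝔪_D, 𝔪_F` such
that with `𝔪_A = (𝔪_D, 𝔪_F)` and `𝔪_B = (𝔪_D, 𝔪_F, 𝔪_C)` both sequences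
become `V_d`-strict for the induced quotient filtrations: exact on every
filtration level `F^j`. -/
theorem strictify_two_short_exact_sequences
    (n d : ℕ) (hd : d ≤ n) (dd aa ff bb cc : ℕ)
    (D A F B C : Type)
    [AddCommGroup D] [Module (Weyl n) D] [AddCommGroup A] [Module (Weyl n) A]
    [AddCommGroup F] [Module (Weyl n) F] [AddCommGroup B] [Module (Weyl n) B]
    [AddCommGroup C] [Module (Weyl n) C]
    (ιDA : D →ₗ[Weyl n] A) (πAF : A →ₗ[Weyl n] F)
    (ιAB : A →ₗ[Weyl n] B) (πBC : B →ₗ[Weyl n] C)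
    (h1inj : Function.Injective ιDA) (h1surj : Function.Surjective πAF)
    (h1exact : ∀ y : A, πAF y = 0 ↔ ∃ x : D, ιDA x = y)
    (h2inj : Function.Injective ιAB) (h2surj : Function.Surjective πBC)
    (h2exact : ∀ y : B, πBC y = 0 ↔ ∃ x : A, ιAB x = y)
    (pD : (Fin dd → Weyl n) →ₗ[Weyl n] D) (hpD : Function.Surjective pD)
    (pA : (Fin aa → Weyl n) →ₗ[Weyl n] A) (hpA : Function.Surjective pA)
    (pF : (Fin ff → Weyl n) →ₗ[Weyl n] F) (hpF : Function.Surjective pF)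
    (pB : (Fin bb → Weyl n) →ₗ[Weyl n] B) (hpB : Function.Surjective pB)
    (pC : (Fin cc → Weyl n) →ₗ[Weyl n] C) (hpC : Function.Surjective pC)
    (𝔪C : Fin cc → ℤ) :
    ∃ (pQA : ((Fin dd → Weyl n) × (Fin ff → Weyl n)) →ₗ[Weyl n] A)
      (pQB : ((Fin dd → Weyl n) × (Fin ff → Weyl n) × (Fin cc → Weyl n)) →ₗ[Weyl n] B)
      (𝔪D : Fin dd → ℤ) (𝔪F : Fin ff → ℤ),
      Function.Surjective pQA ∧ Function.Surjective pQB ∧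
      -- compatibility with the given maps
      (∀ u, pQA (u, 0) = ιDA (pD u)) ∧
      (∀ u v, πAF (pQA (u, v)) = pF v) ∧
      (∀ u v, pQB (u, v, 0) = ιAB (pQA (u, v))) ∧
      (∀ u v w, πBC (pQB (u, v, w)) = pC w) ∧
      -- V_d-strictness of `0 → D → A → F → 0` for the quotient filtrations
      (∀ j : ℤ,
        (∀ x ∈ pD '' VfilFree n d 𝔪D j,
          ιDA x ∈ pQA '' {w | w.1 ∈ VfilFree n d 𝔪D j ∧ w.2 ∈ VfilFree n d 𝔪F j}) ∧
        (∀ y ∈ pQA '' {w | w.1 ∈ VfilFree n d 𝔪D j ∧ w.2 ∈ VfilFree n d 𝔪F j},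
          πAF y ∈ pF '' VfilFree n d 𝔪F j) ∧
        (∀ y ∈ pQA '' {w | w.1 ∈ VfilFree n d 𝔪D j ∧ w.2 ∈ VfilFree n d 𝔪F j},
          πAF y = 0 → ∃ x ∈ pD '' VfilFree n d 𝔪D j, ιDA x = y) ∧
        (∀ z ∈ pF '' VfilFree n d 𝔪F j,
          ∃ y ∈ pQA '' {w | w.1 ∈ VfilFree n d 𝔪D j ∧ w.2 ∈ VfilFree n d 𝔪F j},
            πAF y = z)) ∧
      -- V_d-strictness of `0 → A → B → C → 0` for the quotient filtrations
      (∀ j : ℤ,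
        (∀ x ∈ pQA '' {w | w.1 ∈ VfilFree n d 𝔪D j ∧ w.2 ∈ VfilFree n d 𝔪F j},
          ιAB x ∈ pQB '' {w | w.1 ∈ VfilFree n d 𝔪D j ∧
            w.2.1 ∈ VfilFree n d 𝔪F j ∧ w.2.2 ∈ VfilFree n d 𝔪C j}) ∧
        (∀ y ∈ pQB '' {w | w.1 ∈ VfilFree n d 𝔪D j ∧
            w.2.1 ∈ VfilFree n d 𝔪F j ∧ w.2.2 ∈ VfilFree n d 𝔪C j},
          πBC y ∈ pC '' VfilFree n d 𝔪C j) ∧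
        (∀ y ∈ pQB '' {w | w.1 ∈ VfilFree n d 𝔪D j ∧
            w.2.1 ∈ VfilFree n d 𝔪F j ∧ w.2.2 ∈ VfilFree n d 𝔪C j},
          πBC y = 0 →
            ∃ x ∈ pQA '' {w | w.1 ∈ VfilFree n d 𝔪D j ∧ w.2 ∈ VfilFree n d 𝔪F j},
              ιAB x = y) ∧
        (∀ z ∈ pC '' VfilFree n d 𝔪C j,
          ∃ y ∈ pQB '' {w | w.1 ∈ VfilFree n d 𝔪D j ∧
              w.2.1 ∈ VfilFree n d 𝔪F j ∧ w.2.2 ∈ VfilFree n d 𝔪C j},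
            πBC y = z)) := by
  obtain ⟨sF, hsF⟩ := Module.projective_lifting_property πAF pF h1surj
  obtain ⟨sC, hsC⟩ := Module.projective_lifting_property πBC pC h2surj
  have hsF' : ∀ v, πAF (sF v) = pF v := fun v => LinearMap.congr_fun hsF v
  have hsC' : ∀ w, πBC (sC w) = pC w := fun w => LinearMap.congr_fun hsC w
  have hDF : ∀ x, πAF (ιDA x) = 0 := fun x => (h1exact _).2 ⟨x, rfl⟩
  have hAC : ∀ x, πBC (ιAB x) = 0 := fun x => (h2exact _).2 ⟨x, rfl⟩
  let pQA : ((Fin dd → Weyl n) × (Fin ff → Weyl n)) →ₗ[Weyl n] A := (ιDA ∘ₗ pD).coprod sF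
  have hpQA : ∀ u v, pQA (u, v) = ιDA (pD u) + sF v := fun u v => rfl
  let pQB : ((Fin dd → Weyl n) × (Fin ff → Weyl n) × (Fin cc → Weyl n)) →ₗ[Weyl n] B :=
    (ιAB ∘ₗ ιDA ∘ₗ pD).coprod ((ιAB ∘ₗ sF).coprod sC)
  have hpQB : ∀ u v w, pQB (u, v, w) = ιAB (pQA (u, v)) + sC w := fun u v w => by
    rw [hpQA, map_add, add_assoc]
    rfl
  have hπA : ∀ u v, πAF (pQA (u, v)) = pF v := fun u v => by
    rw [hpQA, map_add, hDF, zero_add, hsF']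
  have hπB : ∀ u v w, πBC (pQB (u, v, w)) = pC w := fun u v w => by
    rw [hpQB, map_add, hAC, zero_add, hsC']
  have hliftA : ∀ y v, πAF y = pF v → ∃ u, pQA (u, v) = y := fun y v h => by
    obtain ⟨x, hx⟩ := (h1exact (y - sF v)).1 (by rw [map_sub, h, hsF', sub_self])
    obtain ⟨u, rfl⟩ := hpD x
    exact ⟨u, by rw [hpQA, hx, sub_add_cancel]⟩
  have hsurjA : Function.Surjective pQA := fun y => by
    obtain ⟨v, hv⟩ := hpF (πAF y)
    obtain ⟨u, hu⟩ := hliftA y v hv.symm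
    exact ⟨(u, v), hu⟩
  have hliftB : ∀ y w, πBC y = pC w →
      ∃ p : (Fin dd → Weyl n) × (Fin ff → Weyl n), pQB (p.1, p.2, w) = y := fun y w h => by
    obtain ⟨x, hx⟩ := (h2exact (y - sC w)).1 (by rw [map_sub, h, hsC', sub_self])
    obtain ⟨p, rfl⟩ := hsurjA x
    exact ⟨p, by rw [hpQB, hx, sub_add_cancel]⟩
  have hsurjB : Function.Surjective pQB := fun y => by
    obtain ⟨w, hw⟩ := hpC (πBC y)
    obtain ⟨p, hp⟩ := hliftB y w hw.symm
    exact ⟨_, hp⟩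
  have hanti : ∀ {m c c' : ℕ} (j : ℤ), c ≤ c' →
      VfilFree n d (fun _ : Fin m => -(c : ℤ)) j ⊆ VfilFree n d (fun _ => -(c' : ℤ)) j :=
    fun j h => VfilFree_antitone fun _ => by simpa using h
  -- shifts making the kernel of `pC` liftable to `P_D ⊕ P_F`
  obtain ⟨cF, hcF⟩ := exists_uniform_lift (d := d) 𝔪C (LinearMap.ker pC) sC (ιAB ∘ₗ pQA)
    (fun w hw => by
      obtain ⟨x, hx⟩ := (h2exact (sC w)).1 (by rw [hsC', LinearMap.mem_ker.1 hw])
      obtain ⟨p, rfl⟩ := hsurjA x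
      exact ⟨p, hx⟩)
    (fun c j => (vfilFreeSubgroup n d (fun _ => -(c : ℤ)) j).prod
      (vfilFreeSubgroup n d (fun _ => -(c : ℤ)) j))
    (fun j c c' h p hp => ⟨hanti j h hp.1, hanti j h hp.2⟩)
    (fun c i j a ha p hp => ⟨smul_mem_VfilFree ha hp.1, smul_mem_VfilFree ha hp.2⟩)
    (fun j p => by
      obtain ⟨c₁, h₁⟩ := exists_mem_VfilFree d j p.1
      obtain ⟨c₂, h₂⟩ := exists_mem_VfilFree d j p.2
      exact ⟨max c₁ c₂, hanti j (le_max_left _ _) h₁, hanti j (le_max_right _ _) h₂⟩)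
  -- shifts making the kernel of `pF` liftable to `P_D`
  obtain ⟨cD, hcD⟩ := exists_uniform_lift (d := d) (fun _ => -(cF : ℤ)) (LinearMap.ker pF) sF
    (ιDA ∘ₗ pD)
    (fun v hv => by
      obtain ⟨x, hx⟩ := (h1exact (sF v)).1 (by rw [hsF', LinearMap.mem_ker.1 hv])
      obtain ⟨u, rfl⟩ := hpD x
      exact ⟨u, hx⟩)
    (fun c j => vfilFreeSubgroup n d (fun _ => -(c : ℤ)) j)
    (fun j c c' h p hp => hanti j h hp)
    (fun c i j a ha p hp => smul_mem_VfilFree ha hp)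
    (fun j p => exists_mem_VfilFree d j p)
  have hadd : ∀ {m : ℕ} (𝔪 : Fin m → ℤ) (j : ℤ) {u v : Fin m → Weyl n},
      u ∈ VfilFree n d 𝔪 j → v ∈ VfilFree n d 𝔪 j → u + v ∈ VfilFree n d 𝔪 j :=
    fun 𝔪 j => (vfilFreeSubgroup n d 𝔪 j).add_mem
  refine ⟨pQA, pQB, fun _ => -((max cF cD : ℕ) : ℤ), fun _ => -(cF : ℤ), hsurjA, hsurjB,
    fun u => by rw [hpQA, map_zero, add_zero], hπA,
    fun u v => by rw [hpQB, map_zero, add_zero], hπB, fun j => ⟨?_, ?_, ?_, ?_⟩,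
    fun j => ⟨?_, ?_, ?_, ?_⟩⟩
  · rintro _ ⟨u, hu, rfl⟩
    exact ⟨(u, 0), ⟨hu, zero_mem_VfilFree _ j⟩, by rw [hpQA, map_zero, add_zero]⟩
  · rintro _ ⟨⟨u, v⟩, ⟨hu, hv⟩, rfl⟩
    exact ⟨v, hv, (hπA u v).symm⟩
  · rintro _ ⟨⟨u, v⟩, ⟨hu, hv⟩, rfl⟩ h
    rw [hπA] at h
    obtain ⟨u', hu', e⟩ := hcD j v hv h
    refine ⟨_, ⟨u + u', hadd _ j hu (hanti j (le_max_right _ _) hu'), rfl⟩, ?_⟩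
    rw [hpQA, ← e, map_add, map_add]
    rfl
  · rintro _ ⟨v, hv, rfl⟩
    exact ⟨_, ⟨(0, v), ⟨zero_mem_VfilFree _ j, hv⟩, rfl⟩, hπA 0 v⟩
  · rintro _ ⟨⟨u, v⟩, ⟨hu, hv⟩, rfl⟩
    exact ⟨(u, v, 0), ⟨hu, hv, zero_mem_VfilFree _ j⟩, by rw [hpQB, map_zero, add_zero]⟩
  · rintro _ ⟨⟨u, v, w⟩, ⟨hu, hv, hw⟩, rfl⟩
    exact ⟨w, hw, (hπB u v w).symm⟩
  · rintro _ ⟨⟨u, v, w⟩, ⟨hu, hv, hw⟩, rfl⟩ h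
    rw [hπB] at h
    obtain ⟨⟨u', v'⟩, ⟨hu', hv'⟩, e⟩ := hcF j w hw h
    refine ⟨_, ⟨(u, v) + (u', v'), ⟨hadd _ j hu (hanti j (le_max_left _ _) hu'),
      hadd _ j hv hv'⟩, rfl⟩, ?_⟩
    rw [hpQB, ← e, map_add, map_add]
    rfl
  · rintro _ ⟨w, hw, rfl⟩
    exact ⟨_, ⟨(0, 0, w), ⟨zero_mem_VfilFree _ j, zero_mem_VfilFree _ j, hw⟩, rfl⟩, hπB 0 0 w⟩
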